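/- Let f̄ : [−1,1]ⁿ × [−1,1]ᵐ → ℝ (with n, m ≥ 1) be a smooth function of (x, w) ∈ [−1,1]^{n+m} which is analytic on the complex region { (x, w) ∈ ℂ^{n+m} : Re(x₁² + ⋯ + xₙ² + w₁² + ⋯ + w_m²) ≥ −t² } for some t > 0. Then f̄ has a uniformly and absolutely convergent multivariate Chebyshev series f̄(x,w) = Σ_{k₁,…,kₙ,l₁,…,l_m ≥ 0} b_{k₁,…,kₙ,l₁,…,l_m} T_{k₁}(x₁)⋯T_{kₙ}(xₙ) T_{l₁}(w₁)⋯T_{l_m}(w_m), and the coefficients satisfy the exponential decay property: there is a constant C such that |b_s| ≤ C·(1+t)^{−‖s‖₂} for every multi-index s = (k₁,…,kₙ,l₁,…,l_m), where ‖s‖₂ is the Euclidean norm of the multi-index. -/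

import Mathlib

open Set Polynomial

open MeasureTheory Filter Topology UnitAddTorus

theorem Real.sinh_mul_le {a u : ℝ} (ha : 0 ≤ a) (hu0 : 0 ≤ u) (hu1 : u ≤ 1) :
    Real.sinh (a * u) ≤ u * Real.sinh a := by
  have hconv : ConvexOn ℝ (Ici 0) Real.sinh := by
    refine convexOn_of_deriv2_nonneg (convex_Ici 0) Real.continuous_sinh.continuousOn
      Real.differentiable_sinh.differentiableOn ?_ ?_
    · rw [Real.deriv_sinh]
      exact Real.differentiable_cosh.differentiableOn
    · intro x hx
      rw [interior_Ici] at hx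
      simpa using (le_of_lt hx : (0 : ℝ) ≤ x)
  have := hconv.2 (mem_Ici.2 ha) (mem_Ici.2 le_rfl) hu0 (sub_nonneg.2 hu1) (by ring)
  simpa [mul_comm] using this

theorem Real.sinh_mul_sq_le {a u : ℝ} (hu : u ^ 2 ≤ 1) :
    Real.sinh (a * u) ^ 2 ≤ u ^ 2 * Real.sinh a ^ 2 := by
  have h : Real.sinh (|a| * |u|) ≤ |u| * Real.sinh |a| :=
    Real.sinh_mul_le (abs_nonneg a) (abs_nonneg u) (by rwa [← sq_le_one_iff_abs_le_one])
  have h0 : 0 ≤ Real.sinh (|a| * |u|) := Real.sinh_nonneg_iff.2 (by positivity)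
  rw [← abs_mul, ← Real.abs_sinh] at h h0
  rw [← Real.abs_sinh] at h
  have := pow_le_pow_left₀ h0 h 2
  rwa [mul_pow, sq_abs, sq_abs, sq_abs] at this

theorem Complex.neg_sinh_im_sq_le_re_cos_sq (z : ℂ) :
    -Real.sinh z.im ^ 2 ≤ (Complex.cos z ^ 2).re := by
  have h : Complex.cos z = ((Real.cos z.re * Real.cosh z.im : ℝ) : ℂ)
      - ((Real.sin z.re * Real.sinh z.im : ℝ) : ℂ) * Complex.I := by
    rw [Complex.cos_eq]
    push_cast
    ring
  have h2 : (Complex.cos z ^ 2).re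
      = (Real.cos z.re * Real.cosh z.im) ^ 2 - (Real.sin z.re * Real.sinh z.im) ^ 2 := by
    rw [h, sq, Complex.mul_re]
    simp only [Complex.sub_re, Complex.sub_im, Complex.re_ofReal_mul, Complex.im_ofReal_mul,
      Complex.ofReal_re, Complex.ofReal_im, Complex.I_re, Complex.I_im]
    ring
  rw [h2, mul_pow, mul_pow]
  nlinarith [Real.sin_sq_le_one z.re, sq_nonneg (Real.sinh z.im),
    mul_nonneg (sq_nonneg (Real.cos z.re)) (sq_nonneg (Real.cosh z.im))]

section TorusCos

variable {d : Type*}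

/-- The point `(cos (2πθⱼ + ζ vⱼ))ⱼ` of `ℂᵈ`, for `θ` in the torus `(ℝ / ℤ)ᵈ`. -/
noncomputable def torusCos (v : d → ℝ) (ζ : ℂ) (θ : UnitAddTorus d) : d → ℂ := fun j =>
  (fourier 1 (θ j) * Complex.exp (ζ * v j * Complex.I)
    + fourier (-1) (θ j) * Complex.exp (-(ζ * v j * Complex.I))) / 2

theorem continuous_torusCos :
    Continuous fun p : (d → ℝ) × ℂ × UnitAddTorus d => torusCos p.1 p.2.1 p.2.2 := by
  unfold torusCos
  fun_prop

theorem UnitAddTorus.exists_coe_eq (θ : UnitAddTorus d) :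
    ∃ φ : d → ℝ, θ = fun j => (φ j : UnitAddCircle) := by
  choose φ hφ using fun j => QuotientAddGroup.mk_surjective (θ j)
  exact ⟨φ, funext fun j => (hφ j).symm⟩

theorem torusCos_coe (v : d → ℝ) (ζ : ℂ) (φ : d → ℝ) (j : d) :
    torusCos v ζ (fun j => (φ j : UnitAddCircle)) j
      = Complex.cos (2 * Real.pi * φ j + ζ * v j) := by
  simp only [torusCos, fourier_coe_apply, ← Complex.exp_add, Complex.cos]
  congr 3 <;> push_cast <;> ring_nf

theorem neg_sinh_sq_le_re_sum_torusCos_sq [Fintype d] {v : d → ℝ} (hv : ∑ j, v j ^ 2 ≤ 1) (ζ : ℂ)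
    (θ : UnitAddTorus d) : -Real.sinh ζ.im ^ 2 ≤ (∑ j, torusCos v ζ θ j ^ 2).re := by
  obtain ⟨φ, rfl⟩ := UnitAddTorus.exists_coe_eq θ
  have hj (j : d) : -(v j ^ 2 * Real.sinh ζ.im ^ 2)
      ≤ (torusCos v ζ (fun j => (φ j : UnitAddCircle)) j ^ 2).re := by
    rw [torusCos_coe]
    refine le_trans (neg_le_neg ?_) (Complex.neg_sinh_im_sq_le_re_cos_sq _)
    have h1 : v j ^ 2 ≤ 1 :=
      (Finset.single_le_sum (fun i _ => sq_nonneg (v i)) (Finset.mem_univ j)).trans hv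
    have h2 : (2 * (Real.pi : ℂ) * φ j + ζ * v j).im = ζ.im * v j := by simp
    rw [h2]
    exact Real.sinh_mul_sq_le h1
  rw [Complex.re_sum]
  refine le_trans ?_ (Finset.sum_le_sum fun j _ => hj j)
  rw [Finset.sum_neg_distrib, ← Finset.sum_mul]
  nlinarith [sq_nonneg (Real.sinh ζ.im)]

theorem neg_sq_le_re_sum_torusCos_sq [Fintype d] {t : ℝ} (ht : 0 ≤ t) {v : d → ℝ}
    (hv : ∑ j, v j ^ 2 ≤ 1) {ζ : ℂ} (hζ : |ζ.im| ≤ Real.arsinh t) (θ : UnitAddTorus d) :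
    -(t ^ 2) ≤ (∑ j, torusCos v ζ θ j ^ 2).re := by
  refine le_trans (neg_le_neg ?_) (neg_sinh_sq_le_re_sum_torusCos_sq hv ζ θ)
  rw [sq_le_sq, Real.abs_sinh, abs_of_nonneg ht, ← Real.sinh_arsinh t]
  exact Real.sinh_le_sinh.2 hζ

theorem torusCos_ofReal (v : d → ℝ) (r : ℝ) (θ : UnitAddTorus d) :
    torusCos v r θ = torusCos 0 0
      (θ + fun j => ((r * v j / (2 * Real.pi) : ℝ) : UnitAddCircle)) := by
  obtain ⟨φ, rfl⟩ := UnitAddTorus.exists_coe_eq θ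
  ext j
  have : ((fun j => (φ j : UnitAddCircle))
      + fun j => ((r * v j / (2 * Real.pi) : ℝ) : UnitAddCircle))
      = fun j => ((φ j + r * v j / (2 * Real.pi) : ℝ) : UnitAddCircle) := by
    ext j; simp
  rw [this, torusCos_coe, torusCos_coe]
  congr 1
  have : (Real.pi : ℂ) ≠ 0 := by exact_mod_cast Real.pi_ne_zero
  push_cast; simp; field_simp

theorem mFourier_add_coe [Fintype d] (k : d → ℤ) (τ : d → ℝ) (θ : UnitAddTorus d) :
    mFourier k (θ + fun j => (τ j : UnitAddCircle))
      = mFourier k θ * Complex.exp (2 * Real.pi * (∑ j, k j * τ j : ℝ) * Complex.I) := by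
  obtain ⟨φ, rfl⟩ := UnitAddTorus.exists_coe_eq θ
  have : ((fun j => (φ j : UnitAddCircle)) + fun j => (τ j : UnitAddCircle))
      = fun j => ((φ j + τ j : ℝ) : UnitAddCircle) := by
    ext j; simp
  rw [this]
  simp only [mFourier, ContinuousMap.coe_mk, fourier_coe_apply, ← Complex.exp_sum,
    ← Complex.exp_add]
  congr 1
  push_cast
  rw [Finset.mul_sum, Finset.sum_mul, ← Finset.sum_add_distrib]
  exact Finset.sum_congr rfl fun j _ => by ring

/-- The derivative of `torusCos` with respect to the complex shift. -/
noncomputable def torusCosDeriv (v : d → ℝ) (ζ : ℂ) (θ : UnitAddTorus d) : d → ℂ := fun j =>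
  (fourier 1 (θ j) * (Complex.exp (ζ * v j * Complex.I) * (v j * Complex.I))
    + fourier (-1) (θ j) * (Complex.exp (-(ζ * v j * Complex.I)) * -(v j * Complex.I))) / 2

theorem continuous_torusCosDeriv (v : d → ℝ) :
    Continuous fun p : ℂ × UnitAddTorus d => torusCosDeriv v p.1 p.2 := by
  unfold torusCosDeriv
  fun_prop

theorem hasDerivAt_torusCos [Fintype d] (v : d → ℝ) (ζ : ℂ) (θ : UnitAddTorus d) :
    HasDerivAt (fun ζ => torusCos v ζ θ) (torusCosDeriv v ζ θ) ζ := by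
  rw [hasDerivAt_pi]
  intro j
  have h : HasDerivAt (fun ζ : ℂ => ζ * v j * Complex.I) (v j * Complex.I) ζ := by
    simpa [mul_assoc] using (hasDerivAt_id ζ).mul_const ((v j : ℂ) * Complex.I)
  exact ((h.cexp.const_mul _).add (h.neg.cexp.const_mul _)).div_const 2

end TorusCos

theorem differentiableOn_integral_of_continuousOn {α : Type*} [TopologicalSpace α] [CompactSpace α]
    [MeasurableSpace α] [OpensMeasurableSpace α] {μ : Measure α} [IsFiniteMeasure μ]
    {S : Set ℂ} (hS : IsOpen S) {f f' : ℂ → α → ℂ}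
    (hf : ContinuousOn (Function.uncurry f) (S ×ˢ univ))
    (hf' : ContinuousOn (Function.uncurry f') (S ×ˢ univ))
    (hd : ∀ ζ ∈ S, ∀ a, HasDerivAt (f · a) (f' ζ a) ζ) :
    DifferentiableOn ℂ (fun ζ => ∫ a, f ζ a ∂μ) S := by
  have slice {g : ℂ → α → ℂ} (hg : ContinuousOn (Function.uncurry g) (S ×ˢ univ)) {ζ : ℂ}
      (hζ : ζ ∈ S) : Continuous (g ζ) :=
    hg.comp_continuous (f := fun a => (ζ, a)) (by fun_prop) fun a => ⟨hζ, mem_univ a⟩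
  intro ζ hζ
  obtain ⟨ε, hε, hball⟩ := Metric.nhds_basis_closedBall.mem_iff.1 (hS.mem_nhds hζ)
  obtain ⟨M, hM⟩ := ((isCompact_closedBall ζ ε).prod isCompact_univ).exists_bound_of_continuousOn
    (hf'.mono (prod_mono hball subset_rfl))
  refine DifferentiableAt.differentiableWithinAt (HasDerivAt.differentiableAt
    (hasDerivAt_integral_of_dominated_loc_of_deriv_le (F' := f') (bound := fun _ => M)
      (Metric.closedBall_mem_nhds ζ hε) ?_ ?_ ?_ ?_ (integrable_const M) ?_).2)
  · filter_upwards [hS.mem_nhds hζ] with z hz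
    exact (slice hf hz).stronglyMeasurable.aestronglyMeasurable
  · exact (slice hf hζ).integrable_of_hasCompactSupport (HasCompactSupport.of_compactSpace _)
  · exact (slice hf' hζ).aestronglyMeasurable
  · exact .of_forall fun a z hz => hM (z, a) ⟨hz, mem_univ a⟩
  · exact .of_forall fun a z hz => hd z (hball hz) a

section Coefficients

variable {d : Type*} [Fintype d]

theorem continuousOn_comp_torusCos {E : Type*} [TopologicalSpace E] {t : ℝ} (ht : 0 ≤ t)
    {F : (d → ℂ) → E} (hF : ContinuousOn F {z | -(t ^ 2) ≤ (∑ j, z j ^ 2).re}) :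
    ContinuousOn (fun p : (d → ℝ) × ℂ × UnitAddTorus d => F (torusCos p.1 p.2.1 p.2.2))
      ({v | ∑ j, v j ^ 2 ≤ 1} ×ˢ {ζ | |ζ.im| ≤ Real.arsinh t} ×ˢ univ) := by
  refine hF.comp continuous_torusCos.continuousOn ?_
  rintro ⟨v, ζ, θ⟩ ⟨hv, hζ, -⟩
  exact neg_sq_le_re_sum_torusCos_sq ht hv hζ θ

/-- The restriction of `F` to the real cube, pulled back to the torus. -/
noncomputable def torusPullback {t : ℝ} (ht : 0 ≤ t) {F : (d → ℂ) → ℂ}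
    (hF : ContinuousOn F {z | -(t ^ 2) ≤ (∑ j, z j ^ 2).re}) : C(UnitAddTorus d, ℂ) where
  toFun θ := F (torusCos 0 0 θ)
  continuous_toFun := (continuousOn_comp_torusCos ht hF).comp_continuous
    (f := fun θ => ((0 : d → ℝ), (0 : ℂ), θ)) (by fun_prop) fun θ => by
      simp [Real.arsinh_nonneg_iff.2 ht]

theorem mFourierCoeff_torusPullback {t : ℝ} (ht : 0 < t) {F : (d → ℂ) → ℂ}
    (hF : AnalyticOnNhd ℂ F {z | -(t ^ 2) ≤ (∑ j, z j ^ 2).re}) (k : d → ℤ) {v : d → ℝ}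
    (hv : ∑ j, v j ^ 2 ≤ 1) {ζ : ℂ} (hζ : |ζ.im| < Real.arsinh t) :
    mFourierCoeff (torusPullback ht.le hF.continuousOn) k
      = ∫ θ, mFourier (-k) θ * (Complex.exp (-(ζ * (∑ j, k j * v j : ℝ) * Complex.I))
          * F (torusCos v ζ θ)) ∂(Measure.pi fun _ : d => AddCircle.haarAddCircle) := by
  set κ : ℝ := ∑ j, k j * v j with hκ
  set μ : Measure (UnitAddTorus d) := Measure.pi fun _ : d => AddCircle.haarAddCircle with hμ
  set S : Set ℂ := {ζ | |ζ.im| < Real.arsinh t} with hS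
  have hSo : IsOpen S := isOpen_lt (by fun_prop) continuous_const
  have hSeq : S = Complex.im ⁻¹' Ioo (-Real.arsinh t) (Real.arsinh t) := by
    ext z; simp [hS, abs_lt]
  have hSc : IsPreconnected S := by
    rw [hSeq]
    exact ((convex_Ioo _ _).linear_preimage Complex.imLm).isPreconnected
  have hmaps {ζ : ℂ} (hζ : ζ ∈ S) (θ : UnitAddTorus d) :
      torusCos v ζ θ ∈ {z : d → ℂ | -(t ^ 2) ≤ (∑ j, z j ^ 2).re} :=
    neg_sq_le_re_sum_torusCos_sq ht.le hv (le_of_lt hζ) θ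
  have hXc : Continuous fun p : ℂ × UnitAddTorus d => torusCos v p.1 p.2 :=
    continuous_torusCos.comp (f := fun p : ℂ × UnitAddTorus d => (v, p.1, p.2)) (by fun_prop)
  have hFX : ContinuousOn (fun p : ℂ × UnitAddTorus d => F (torusCos v p.1 p.2)) (S ×ˢ univ) :=
    hF.continuousOn.comp hXc.continuousOn fun p hp => hmaps hp.1 p.2
  have hF'X : ContinuousOn (fun p : ℂ × UnitAddTorus d => fderiv ℂ F (torusCos v p.1 p.2))
      (S ×ˢ univ) :=
    hF.fderiv.continuousOn.comp hXc.continuousOn fun p hp => hmaps hp.1 p.2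
  have hX'c := continuous_torusCosDeriv v
  have hmc : Continuous fun p : ℂ × UnitAddTorus d => mFourier (-k) p.2 :=
    (mFourier (-k)).continuous.comp continuous_snd
  have hdiff : DifferentiableOn ℂ (fun ζ => ∫ θ, mFourier (-k) θ *
      (Complex.exp (-(ζ * κ * Complex.I)) * F (torusCos v ζ θ)) ∂μ) S := by
    refine differentiableOn_integral_of_continuousOn hSo
      (f' := fun ζ θ => mFourier (-k) θ *
        (Complex.exp (-(ζ * κ * Complex.I)) * -(κ * Complex.I) * F (torusCos v ζ θ)
        + Complex.exp (-(ζ * κ * Complex.I))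
          * fderiv ℂ F (torusCos v ζ θ) (torusCosDeriv v ζ θ))) ?_ ?_ ?_
    · exact hmc.continuousOn.mul ((Continuous.continuousOn (by fun_prop)).mul hFX)
    · exact hmc.continuousOn.mul (((Continuous.continuousOn (by fun_prop)).mul hFX).add
        ((Continuous.continuousOn (by fun_prop)).mul (hF'X.clm_apply hX'c.continuousOn)))
    · intro z hz θ
      have h1 : HasDerivAt (fun z : ℂ => -(z * κ * Complex.I)) (-(κ * Complex.I)) z := by
        have h := ((hasDerivAt_id z).mul_const ((κ : ℂ) * Complex.I)).fun_neg
        simpa [mul_assoc] using h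
      have h2 := (hF _ (hmaps hz θ)).differentiableAt.hasFDerivAt.comp_hasDerivAt z
        (hasDerivAt_torusCos v z θ)
      exact (h1.cexp.mul h2).const_mul _
  have hreal (r : ℝ) : ∫ θ, mFourier (-k) θ *
      (Complex.exp (-(r * κ * Complex.I)) * F (torusCos v r θ)) ∂μ
      = mFourierCoeff (torusPullback ht.le hF.continuousOn) k := by
    have h0 : mFourierCoeff (torusPullback ht.le hF.continuousOn) k
        = ∫ θ, mFourier (-k) θ * F (torusCos 0 0 θ) ∂μ := rfl
    rw [h0, ← integral_add_right_eq_self (μ := μ) (fun θ => mFourier (-k) θ * F (torusCos 0 0 θ))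
      (fun j => ((r * v j / (2 * Real.pi) : ℝ) : UnitAddCircle))]
    refine integral_congr_ae (.of_forall fun θ => ?_)
    dsimp only
    rw [torusCos_ofReal, mFourier_add_coe, ← mul_assoc]
    congr 3
    have : (Real.pi : ℂ) ≠ 0 := by exact_mod_cast Real.pi_ne_zero
    rw [hκ]
    push_cast
    rw [Finset.mul_sum, Finset.sum_mul, Finset.mul_sum, Finset.sum_mul, ← Finset.sum_neg_distrib]
    refine Finset.sum_congr rfl fun j _ => ?_
    simp only [Pi.neg_apply]
    push_cast
    field_simp
  have h0S : (0 : ℂ) ∈ S := by simpa [hS] using Real.arsinh_pos_iff.2 ht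
  refine ((hdiff.analyticOnNhd hSo).eqOn_of_preconnected_of_frequently_eq
    (g := fun _ => mFourierCoeff (torusPullback ht.le hF.continuousOn) k)
    analyticOnNhd_const hSc h0S ?_ hζ).symm
  have htend : Tendsto (fun r : ℝ => (r : ℂ)) (𝓝[≠] 0) (𝓝[≠] 0) := by
    refine tendsto_nhdsWithin_iff.2 ⟨?_, ?_⟩
    · exact tendsto_nhdsWithin_of_tendsto_nhds
        (by simpa using Complex.continuous_ofReal.tendsto 0)
    · filter_upwards [self_mem_nhdsWithin] with r hr
      simpa using hr
  exact htend.frequently (Eventually.of_forall hreal).frequently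

theorem exists_norm_mFourierCoeff_torusPullback_le {t : ℝ} (ht : 0 < t) {F : (d → ℂ) → ℂ}
    (hF : AnalyticOnNhd ℂ F {z | -(t ^ 2) ≤ (∑ j, z j ^ 2).re}) :
    ∃ C : ℝ, 0 ≤ C ∧ ∀ k : d → ℤ, ‖mFourierCoeff (torusPullback ht.le hF.continuousOn) k‖
      ≤ C * (1 + t) ^ (-√(∑ j, (k j : ℝ) ^ 2)) := by
  set l : ℝ := Real.log (1 + t) with hl
  have hl0 : 0 < l := Real.log_pos (by linarith)
  have hlt : l < Real.arsinh t := by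
    rw [hl, Real.arsinh]
    refine Real.log_lt_log (by linarith) ?_
    have : 1 < √(1 + t ^ 2) := by
      rw [Real.lt_sqrt (by norm_num)]
      nlinarith
    linarith
  set ζ : ℂ := -(l * Complex.I) with hζdef
  have hζim : ζ.im = -l := by simp [hζdef]
  have hζ : |ζ.im| < Real.arsinh t := by rwa [hζim, abs_neg, abs_of_pos hl0]
  have hK : IsCompact {v : d → ℝ | ∑ j, v j ^ 2 ≤ 1} := by
    refine (isCompact_univ_pi fun _ : d => isCompact_Icc (a := (-1 : ℝ)) (b := 1)).of_isClosed_subset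
      (isClosed_le (by fun_prop) continuous_const) fun v hv j _ => ?_
    have h1 : v j ^ 2 ≤ 1 :=
      (Finset.single_le_sum (fun i _ => sq_nonneg (v i)) (Finset.mem_univ j)).trans hv
    exact abs_le.1 ((sq_le_one_iff_abs_le_one _).1 h1)
  obtain ⟨C, hC⟩ := (hK.prod ((isCompact_singleton (x := ζ)).prod
    (isCompact_univ (X := UnitAddTorus d)))).exists_bound_of_continuousOn
    ((continuousOn_comp_torusCos ht.le hF.continuousOn).mono
      (prod_mono subset_rfl (prod_mono (singleton_subset_iff.2 (le_of_lt hζ)) subset_rfl)))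
  have hC0 : 0 ≤ C := (norm_nonneg _).trans (hC (0, ζ, 0) (by simp))
  refine ⟨C, hC0, fun k => ?_⟩
  set N : ℝ := √(∑ j, (k j : ℝ) ^ 2) with hN
  have hN2 : N ^ 2 = ∑ j, (k j : ℝ) ^ 2 := Real.sq_sqrt (Finset.sum_nonneg fun j _ => sq_nonneg _)
  set v : d → ℝ := fun j => k j / N with hv
  have hv1 : ∑ j, v j ^ 2 ≤ 1 := by
    simp only [hv, div_pow, ← Finset.sum_div, ← hN2]
    exact div_self_le_one _
  have hκ : ∑ j, k j * v j = N := by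
    have : ∑ j, k j * v j = N ^ 2 / N := by
      rw [hN2, Finset.sum_div]
      exact Finset.sum_congr rfl fun j _ => by simp only [hv]; ring
    rw [this, sq, mul_self_div_self]
  rw [mFourierCoeff_torusPullback ht hF k hv1 hζ, hκ]
  refine (norm_integral_le_of_norm_le_const (C := C * (1 + t) ^ (-N))
    (.of_forall fun θ => ?_)).trans_eq (by simp)
  have h1 : ‖mFourier (-k) θ‖ ≤ 1 := by
    simpa [mFourier_norm] using (mFourier (-k)).norm_coe_le_norm θ
  have h2 : ‖Complex.exp (-(ζ * N * Complex.I))‖ = (1 + t) ^ (-N) := by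
    rw [Complex.norm_exp, Real.rpow_def_of_pos (by linarith), ← hl]
    congr 1
    simp [hζdef]
  rw [norm_mul, norm_mul, h2]
  calc _ ≤ 1 * ((1 + t) ^ (-N) * C) := by
        gcongr
        exact hC (v, ζ, θ) ⟨hv1, rfl, mem_univ _⟩
    _ = _ := by ring

end Coefficients

section Summability

theorem summable_pi_prod_of_nonneg {d ι : Type*} [Fintype d] {f : d → ι → ℝ}
    (hf0 : ∀ j i, 0 ≤ f j i) (hf : ∀ j, Summable (f j)) :
    Summable fun k : d → ι => ∏ j, f j (k j) := by
  classical
  refine summable_of_sum_le (c := ∏ j, ∑' i, f j i)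
    (fun k => Finset.prod_nonneg fun j _ => hf0 j _) fun A => ?_
  calc ∑ k ∈ A, ∏ j, f j (k j)
      ≤ ∑ k ∈ Fintype.piFinset fun j => A.image fun k => k j, ∏ j, f j (k j) :=
        Finset.sum_le_sum_of_subset_of_nonneg
          (fun k hk => Fintype.mem_piFinset.2 fun j => Finset.mem_image_of_mem _ hk)
          fun k _ _ => Finset.prod_nonneg fun j _ => hf0 j _
    _ = ∏ j, ∑ i ∈ A.image fun k => k j, f j i := (Finset.prod_univ_sum _ _).symm
    _ ≤ _ := Finset.prod_le_prod (fun j _ => Finset.sum_nonneg fun i _ => hf0 j i)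
        fun j _ => (hf j).sum_le_tsum _ fun i _ => hf0 j i

theorem summable_rpow_neg_euclidean_norm {d : Type*} [Fintype d] {a : ℝ} (ha : 1 < a) :
    Summable fun k : d → ℤ => a ^ (-√(∑ j, (k j : ℝ) ^ 2)) := by
  have ha0 : 0 < a := by linarith
  set N : ℝ := Fintype.card d + 1 with hN
  have hN0 : 0 < N := by positivity
  set r : ℝ := a ^ (-(1 / N)) with hr
  have hr0 : 0 < r := Real.rpow_pos_of_pos ha0 _
  have hr1 : r < 1 := Real.rpow_lt_one_of_one_lt_of_neg ha (by simpa using hN0)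
  have hs : Summable fun k : ℤ => r ^ k.natAbs :=
    .of_nat_of_neg (by simpa using summable_geometric_of_lt_one hr0.le hr1)
      (by simpa using summable_geometric_of_lt_one hr0.le hr1)
  refine .of_nonneg_of_le (fun k => by positivity) (fun k => ?_)
    (summable_pi_prod_of_nonneg (d := d) (fun _ k => by positivity) fun _ => hs)
  have hle : ∑ j, ((k j).natAbs : ℝ) ≤ N * √(∑ j, (k j : ℝ) ^ 2) := by
    calc ∑ j, ((k j).natAbs : ℝ) ≤ ∑ _j : d, √(∑ j, (k j : ℝ) ^ 2) := by
          refine Finset.sum_le_sum fun j _ => Real.le_sqrt_of_sq_le ?_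
          rw [Nat.cast_natAbs, Int.cast_abs, sq_abs]
          exact Finset.single_le_sum (f := fun j => (k j : ℝ) ^ 2) (fun i _ => sq_nonneg _)
            (Finset.mem_univ j)
      _ ≤ _ := by
          rw [Finset.sum_const, Finset.card_univ, nsmul_eq_mul]
          gcongr
          simp [hN]
  rw [Finset.prod_pow_eq_pow_sum, hr, ← Real.rpow_natCast, ← Real.rpow_mul ha0.le]
  refine Real.rpow_le_rpow_of_exponent_le ha.le ?_
  rw [neg_mul, neg_le_neg_iff, one_div, inv_mul_le_iff₀ hN0]
  push_cast
  exact hle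

end Summability

section Chebyshev

variable {d : Type*} [Fintype d]

theorem sum_mFourier_reflections [DecidableEq d] (k : d → ℤ) (α : d → ℝ) :
    ∑ ε : d → Bool, mFourier k
        (fun j => (((bif ε j then α j else -α j) / (2 * Real.pi) : ℝ) : UnitAddCircle))
      = 2 ^ Fintype.card d
        * ((∏ j, (Chebyshev.T ℝ (k j).natAbs).eval (Real.cos (α j)) : ℝ) : ℂ) := by
  simp only [mFourier, ContinuousMap.coe_mk]
  have h := Finset.prod_univ_sum (fun _ : d => (Finset.univ : Finset Bool)) (fun j e =>
    fourier (k j) (((bif e then α j else -α j) / (2 * Real.pi) : ℝ) : UnitAddCircle))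
  rw [Fintype.piFinset_univ] at h
  rw [← h, Complex.ofReal_prod, ← Finset.card_univ, ← Finset.prod_const, ← Finset.prod_mul_distrib]
  refine Finset.prod_congr rfl fun j _ => ?_
  have hcos : Real.cos ((k j).natAbs * α j) = Real.cos (k j * α j) := by
    rcases Int.natAbs_eq (k j) with h | h
    · conv_rhs => rw [h, Int.cast_natCast]
    · conv_rhs => rw [h, Int.cast_neg, neg_mul, Real.cos_neg, Int.cast_natCast]
  rw [Chebyshev.T_real_cos, Int.cast_natCast, hcos, Fintype.sum_bool, fourier_coe_apply,
    fourier_coe_apply, Complex.ofReal_cos, Complex.cos]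
  have : (Real.pi : ℂ) ≠ 0 := by exact_mod_cast Real.pi_ne_zero
  rw [mul_div_cancel₀ _ two_ne_zero]
  congr 2 <;> push_cast <;> simp only [cond_true, cond_false] <;> push_cast <;> field_simp

theorem finite_natAbs_fiber (s : d → ℕ) : Finite {k : d → ℤ // (fun j => (k j).natAbs) = s} ∧
    Nat.card {k : d → ℤ // (fun j => (k j).natAbs) = s} ≤ 2 ^ Fintype.card d := by
  have hinj : Function.Injective fun (k : {k : d → ℤ // (fun j => (k j).natAbs) = s}) (j : d) =>
      decide (0 ≤ k.1 j) := by
    rintro ⟨k, hk⟩ ⟨l, hl⟩ h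
    ext j
    have h1 := congrFun (hk.trans hl.symm) j
    have h2 := congrFun h j
    simp only [decide_eq_decide] at h1 h2 ⊢
    omega
  refine ⟨.of_injective _ hinj, (Nat.card_le_card_of_injective _ hinj).trans_eq ?_⟩
  rw [Nat.card_fun, Nat.card_eq_fintype_card, Nat.card_eq_fintype_card, Fintype.card_bool]

theorem exists_chebyshev_hasSum {t : ℝ} (ht : 0 < t) {F : (d → ℂ) → ℂ}
    (hF : AnalyticOnNhd ℂ F {z | -(t ^ 2) ≤ (∑ j, z j ^ 2).re}) :
    ∃ b : (d → ℕ) → ℝ, ∃ C : ℝ,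
      (∀ s, |b s| ≤ C * (1 + t) ^ (-√(∑ j, (s j : ℝ) ^ 2))) ∧
      ∀ x : d → ℝ, (∀ j, x j ∈ Icc (-1 : ℝ) 1) →
        HasSum (fun s => b s * ∏ j, (Chebyshev.T ℝ (s j)).eval (x j)) (F fun j => x j).re := by
  classical
  obtain ⟨C, hC0, hC⟩ := exists_norm_mFourierCoeff_torusPullback_le ht hF
  set g := torusPullback ht.le hF.continuousOn with hg
  have hsum : Summable (mFourierCoeff g) :=
    .of_norm_bounded ((summable_rpow_neg_euclidean_norm (by linarith)).mul_left C) hC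
  refine ⟨fun s => ∑' k : {k : d → ℤ // (fun j => (k j).natAbs) = s}, (mFourierCoeff g k.1).re,
    2 ^ Fintype.card d * C, fun s => ?_, fun x hx => ?_⟩
  · obtain ⟨hfin, hcard⟩ := finite_natAbs_fiber s
    have := Fintype.ofFinite {k : d → ℤ // (fun j => (k j).natAbs) = s}
    dsimp only
    rw [tsum_fintype]
    refine (Finset.abs_sum_le_sum_abs _ _).trans ((Finset.sum_le_card_nsmul _ _
      (C * (1 + t) ^ (-√(∑ j, (s j : ℝ) ^ 2))) fun k _ => ?_).trans ?_)
    · refine (Complex.abs_re_le_norm _).trans ((hC k.1).trans_eq ?_)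
      simp only [← k.2, Nat.cast_natAbs, Int.cast_abs, sq_abs]
    · rw [Finset.card_univ, ← Nat.card_eq_fintype_card, nsmul_eq_mul, mul_assoc]
      gcongr
      exact_mod_cast hcard
  · have hcos (j : d) : Real.cos (Real.arccos (x j)) = x j := Real.cos_arccos (hx j).1 (hx j).2
    have hval (ε : d → Bool) : g (fun j =>
        (((bif ε j then Real.arccos (x j) else -Real.arccos (x j)) / (2 * Real.pi) : ℝ) :
          UnitAddCircle)) = F fun j => x j := by
      change F _ = _
      congr 1
      ext j
      have : (Real.pi : ℂ) ≠ 0 := by exact_mod_cast Real.pi_ne_zero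
      rw [torusCos_coe, ← hcos j, Complex.ofReal_cos, hcos j]
      cases ε j <;> push_cast <;> simp only [cond_true, cond_false] <;> push_cast <;> field_simp
        <;> simp
    have h1 := hasSum_sum (s := Finset.univ) fun (ε : d → Bool) _ =>
      hasSum_mFourier_series_apply_of_summable hsum (fun j =>
        (((bif ε j then Real.arccos (x j) else -Real.arccos (x j)) / (2 * Real.pi) : ℝ) :
          UnitAddCircle))
    simp only [hval, smul_eq_mul, ← Finset.mul_sum, sum_mFourier_reflections, hcos,
      Finset.sum_const, Finset.card_univ, Fintype.card_fun, Fintype.card_bool, nsmul_eq_mul,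
      Nat.cast_pow, Nat.cast_ofNat, mul_left_comm _ ((2 : ℂ) ^ Fintype.card d)] at h1
    have h2 := Complex.hasSum_re ((hasSum_mul_left_iff (pow_ne_zero _ two_ne_zero)).1 h1)
    simp only [Complex.re_mul_ofReal] at h2
    rw [← (Equiv.sigmaFiberEquiv fun (k : d → ℤ) j => (k j).natAbs).hasSum_iff] at h2
    refine h2.sigma fun s => ?_
    have h3 : Summable fun k : {k : d → ℤ // (fun j => (k j).natAbs) = s} =>
      (mFourierCoeff g k.1).re := (Complex.hasSum_re hsum.hasSum).summable.subtype _
    have h4 := h3.hasSum.mul_right (∏ j, (Chebyshev.T ℝ (s j)).eval (x j))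
    have h5 : (fun k : {k : d → ℤ // (fun j => (k j).natAbs) = s} =>
        (mFourierCoeff g k.1).re * ∏ j, (Chebyshev.T ℝ (s j)).eval (x j)) = fun k =>
        (mFourierCoeff g k.1).re * ∏ j, (Chebyshev.T ℝ (k.1 j).natAbs).eval (x j) := by
      funext k
      simp only [← k.2]
    rw [h5] at h4
    exact h4

end Chebyshev

/-- **Multivariate Chebyshev series for functions analytic in the hypercube
(Lemma S1, after Trefethen).**
Let `f̄ : [-1,1]ⁿ × [-1,1]ᵐ → ℝ` be a smooth function which extends to a function
analytic on the complex region `{(x,w) : Re(x₁² + ⋯ + xₙ² + w₁² + ⋯ + w_m²) ≥ -t²}`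
for some `t > 0`.  Then `f̄` has a uniformly and absolutely convergent multivariate
Chebyshev series, and the Chebyshev coefficients decay exponentially:
`|b_s| ≤ C·(1+t)^(-‖s‖₂)`. -/
theorem multivariate_chebyshev_series_of_analytic
    (n m : ℕ) (hn : 1 ≤ n) (hm : 1 ≤ m)
    (f : (Fin n → ℝ) → (Fin m → ℝ) → ℝ)
    (hf_smooth : ContDiffOn ℝ (⊤ : ℕ∞) (fun xw : (Fin n → ℝ) × (Fin m → ℝ) => f xw.1 xw.2)
      {xw | (∀ i, xw.1 i ∈ Icc (-1:ℝ) 1) ∧ ∀ j, xw.2 j ∈ Icc (-1:ℝ) 1})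
    (t : ℝ) (ht : 0 < t)
    -- the analytic extension to the complex region
    (F : ((Fin n → ℂ) × (Fin m → ℂ)) → ℂ)
    (hF_analytic : AnalyticOnNhd ℂ F
      {z | -(t ^ 2) ≤ (∑ i, z.1 i ^ 2 + ∑ j, z.2 j ^ 2).re})
    (hF_extends : ∀ (x : Fin n → ℝ) (w : Fin m → ℝ),
      (∀ i, x i ∈ Icc (-1:ℝ) 1) → (∀ j, w j ∈ Icc (-1:ℝ) 1) →
      F (fun i => (x i : ℂ), fun j => (w j : ℂ)) = (f x w : ℂ)) :
    ∃ b : ((Fin n → ℕ) × (Fin m → ℕ)) → ℝ,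
      -- the multivariate Chebyshev series converges uniformly to f̄ on the hypercube
      TendstoUniformlyOn
        (fun (A : Finset ((Fin n → ℕ) × (Fin m → ℕ)))
            (xw : (Fin n → ℝ) × (Fin m → ℝ)) =>
          ∑ s ∈ A, b s * (∏ i, (Chebyshev.T ℝ (s.1 i)).eval (xw.1 i))
            * ∏ j, (Chebyshev.T ℝ (s.2 j)).eval (xw.2 j))
        (fun xw => f xw.1 xw.2) Filter.atTop
        {xw | (∀ i, xw.1 i ∈ Icc (-1:ℝ) 1) ∧ ∀ j, xw.2 j ∈ Icc (-1:ℝ) 1} ∧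
      -- the series converges absolutely at each point of the hypercube
      (∀ (x : Fin n → ℝ) (w : Fin m → ℝ),
        (∀ i, x i ∈ Icc (-1:ℝ) 1) → (∀ j, w j ∈ Icc (-1:ℝ) 1) →
        Summable fun s : (Fin n → ℕ) × (Fin m → ℕ) =>
          |b s * (∏ i, (Chebyshev.T ℝ (s.1 i)).eval (x i))
            * ∏ j, (Chebyshev.T ℝ (s.2 j)).eval (w j)|) ∧
      -- exponential decay of the Chebyshev coefficients
      ∃ C : ℝ, ∀ s : (Fin n → ℕ) × (Fin m → ℕ),
        |b s| ≤ C * (1 + t) ^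
          (-Real.sqrt ((∑ i, ((s.1 i : ℝ)) ^ 2) + ∑ j, ((s.2 j : ℝ)) ^ 2)) := by
  
  let L : (Fin n ⊕ Fin m → ℂ) →L[ℂ] (Fin n → ℂ) × (Fin m → ℂ) :=
    (ContinuousLinearMap.pi fun i => .proj (Sum.inl i)).prod
      (ContinuousLinearMap.pi fun j => .proj (Sum.inr j))
  obtain ⟨b, C, hbC, hb⟩ := exists_chebyshev_hasSum ht (F := F ∘ L) fun z hz =>
    (hF_analytic (L z) (by simpa [L, Fintype.sum_sum_type] using hz)).comp (L.analyticAt z)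
  let e := Equiv.sumArrowEquivProdArrow (Fin n) (Fin m) ℕ
  have hinl (s : (Fin n → ℕ) × (Fin m → ℕ)) (i : Fin n) : e.symm s (Sum.inl i) = s.1 i := rfl
  have hinr (s : (Fin n → ℕ) × (Fin m → ℕ)) (j : Fin m) : e.symm s (Sum.inr j) = s.2 j := rfl
  have hdecay (s : (Fin n → ℕ) × (Fin m → ℕ)) : |b (e.symm s)| ≤ C * (1 + t) ^
      (-Real.sqrt ((∑ i, ((s.1 i : ℝ)) ^ 2) + ∑ j, ((s.2 j : ℝ)) ^ 2)) := by
    simpa only [Fintype.sum_sum_type, hinl, hinr] using hbC (e.symm s)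
  have hsummable : Summable fun s : (Fin n → ℕ) × (Fin m → ℕ) => C * (1 + t) ^
      (-Real.sqrt ((∑ i, ((s.1 i : ℝ)) ^ 2) + ∑ j, ((s.2 j : ℝ)) ^ 2)) := by
    have h := (summable_rpow_neg_euclidean_norm (d := Fin n ⊕ Fin m) (a := 1 + t)
      (by linarith)).comp_injective (i := fun (s : (Fin n → ℕ) × (Fin m → ℕ)) j =>
        (e.symm s j : ℤ)) fun s s' h => e.symm.injective <| funext fun j => by
          exact Int.natCast_inj.1 (congrFun h j)
    simpa only [Function.comp_def, Fintype.sum_sum_type, hinl, hinr, Int.cast_natCast]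
      using h.mul_left C
  have hterm (s : (Fin n → ℕ) × (Fin m → ℕ)) (x : Fin n → ℝ) (w : Fin m → ℝ)
      (hx : ∀ i, x i ∈ Icc (-1 : ℝ) 1) (hw : ∀ j, w j ∈ Icc (-1 : ℝ) 1) :
      |b (e.symm s) * (∏ i, (Chebyshev.T ℝ (s.1 i)).eval (x i))
        * ∏ j, (Chebyshev.T ℝ (s.2 j)).eval (w j)| ≤ C * (1 + t) ^
      (-Real.sqrt ((∑ i, ((s.1 i : ℝ)) ^ 2) + ∑ j, ((s.2 j : ℝ)) ^ 2)) := by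
    have hprod {l : ℕ} (k : Fin l → ℕ) (y : Fin l → ℝ) (hy : ∀ i, y i ∈ Icc (-1 : ℝ) 1) :
        |∏ i, (Chebyshev.T ℝ (k i)).eval (y i)| ≤ 1 := by
      rw [Finset.abs_prod]
      exact Finset.prod_le_one (fun i _ => abs_nonneg _) fun i _ =>
        Chebyshev.abs_eval_T_real_le_one _ (abs_le.2 (hy i))
    rw [abs_mul, abs_mul, mul_assoc]
    refine (mul_le_of_le_one_right (abs_nonneg _) ?_).trans (hdecay s)
    exact mul_le_one₀ (hprod _ _ hx) (abs_nonneg _) (hprod _ _ hw)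
  have hhas (x : Fin n → ℝ) (w : Fin m → ℝ)
      (hx : ∀ i, x i ∈ Icc (-1 : ℝ) 1) (hw : ∀ j, w j ∈ Icc (-1 : ℝ) 1) :
      HasSum (fun s : (Fin n → ℕ) × (Fin m → ℕ) =>
        b (e.symm s) * (∏ i, (Chebyshev.T ℝ (s.1 i)).eval (x i))
          * ∏ j, (Chebyshev.T ℝ (s.2 j)).eval (w j)) (f x w) := by
    have h := hb (Sum.elim x w) (by simpa using ⟨hx, hw⟩)
    have hval : (F ∘ L) (fun j => ((Sum.elim x w j : ℝ) : ℂ)) = (f x w : ℂ) := hF_extends x w hx hw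
    rw [hval, Complex.ofReal_re, ← e.symm.hasSum_iff] at h
    simpa only [Function.comp_def, Fintype.prod_sum_type, hinl, hinr, Sum.elim_inl, Sum.elim_inr,
      mul_assoc] using h
  refine ⟨fun s => b (e.symm s), ?_, fun x w hx hw => ?_, C, hdecay⟩
  · refine (tendstoUniformlyOn_tsum hsummable fun s xw hxw =>
      hterm s xw.1 xw.2 hxw.1 hxw.2).congr_right fun xw hxw => ?_
    exact (hhas xw.1 xw.2 hxw.1 hxw.2).tsum_eq
  · exact .of_nonneg_of_le (fun s => abs_nonneg _) (fun s => hterm s x w hx hw) hsummable
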